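/- arXiv:1911.12940 — 2 statements merged into one kernel-verified Lean document; each statement's English description precedes it below -/
import Mathlib

section
/- Let X be a regular T2 space and let 𝒫 be a family of subsets of X which is compact-countable (respectively, locally countable, locally finite, compact-finite). Then the family ℬ = {⟨P₁,...,P_r⟩ : P₁,...,P_r ∈ 𝒫, r ∈ ℕ} is compact-countable (respectively, locally countable, locally finite, compact-finite) in the hyperspace 𝒦(X) with the Vietoris topology. Moreover, if every member of 𝒫 is closed in X, then every member of ℬ is closed in 𝒦(X). -/
open TopologicalSpace Set

/-- The hyperspace `𝒦(X)` of nonempty compact subsets of `X`. -/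
structure VHyper (X : Type*) [TopologicalSpace X] where
  carrier : Set X
  isCompact' : IsCompact carrier
  nonempty' : carrier.Nonempty

namespace VHyper

variable {X : Type*} [TopologicalSpace X]

/-- The basic Vietoris set `⟨P₁, …, P_r⟩` determined by a finite family of subsets of `X`:
all nonempty compact sets contained in the union and meeting every member. -/
def vbox (Ps : Finset (Set X)) : Set (VHyper X) :=
  {A : VHyper X | A.carrier ⊆ ⋃₀ (Ps : Set (Set X)) ∧ ∀ P ∈ Ps, (A.carrier ∩ P).Nonempty}

/-- The Vietoris topology on `𝒦(X)`, generated by the sets `⟨U₁, …, U_k⟩`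
with all `U_i` open. -/
instance : TopologicalSpace (VHyper X) :=
  TopologicalSpace.generateFrom
    {S : Set (VHyper X) | ∃ Ps : Finset (Set X), (∀ U ∈ Ps, IsOpen U) ∧ S = vbox Ps}

end VHyper

/-- `ℱ(X)`: the subspace of `𝒦(X)` consisting of the nonempty finite subsets of `X`. -/
def VFin (X : Type*) [TopologicalSpace X] := {A : VHyper X // A.carrier.Finite}

instance (X : Type*) [TopologicalSpace X] : TopologicalSpace (VFin X) :=
  inferInstanceAs (TopologicalSpace {A : VHyper X // A.carrier.Finite})

/-- `ℱ₂(X)`: the subspace of `𝒦(X)` consisting of the nonempty subsets of `X` of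
cardinality at most 2. -/
def VFin2 (X : Type*) [TopologicalSpace X] := {A : VHyper X // A.carrier.encard ≤ 2}

instance (X : Type*) [TopologicalSpace X] : TopologicalSpace (VFin2 X) :=
  inferInstanceAs (TopologicalSpace {A : VHyper X // A.carrier.encard ≤ 2})

/-- The family `ℬ = {⟨P₁,…,P_r⟩ : P₁,…,P_r ∈ Pfam, r ∈ ℕ}` of basic Vietoris sets built from
members of `Pfam`. -/
def boxFamily {X : Type*} [TopologicalSpace X] (Pfam : Set (Set X)) : Set (Set (VHyper X)) :=
  {B | ∃ Ps : Finset (Set X), Ps.Nonempty ∧ ↑Ps ⊆ Pfam ∧ B = VHyper.vbox Ps}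

section Defs

variable {Y : Type*} [TopologicalSpace Y]

/-- `Pfam` is a k-network: for every compact `C` and open `U ⊇ C` there is a finite
subfamily `Qfam ⊆ Pfam` with `C ⊆ ⋃Qfam ⊆ U`. -/
def IsKNetwork (Pfam : Set (Set Y)) : Prop :=
  ∀ C : Set Y, IsCompact C → ∀ U : Set Y, IsOpen U → C ⊆ U →
    ∃ Qfam : Set (Set Y), Qfam ⊆ Pfam ∧ Qfam.Finite ∧ C ⊆ ⋃₀ Qfam ∧ ⋃₀ Qfam ⊆ U

/-- Every point lies in at most countably many members of `Pfam`. -/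
def PointCountableFam (Pfam : Set (Set Y)) : Prop :=
  ∀ y : Y, {P ∈ Pfam | y ∈ P}.Countable

/-- Every compact set meets at most countably many members of `Pfam`. -/
def CompactCountableFam (Pfam : Set (Set Y)) : Prop :=
  ∀ C : Set Y, IsCompact C → {P ∈ Pfam | (C ∩ P).Nonempty}.Countable

/-- Every point has a neighborhood meeting at most countably many members of `Pfam`. -/
def LocallyCountableFam (Pfam : Set (Set Y)) : Prop :=
  ∀ y : Y, ∃ O ∈ nhds y, {P ∈ Pfam | (O ∩ P).Nonempty}.Countable

/-- Every point has a neighborhood meeting only finitely many members of `Pfam`. -/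
def LocallyFiniteFam (Pfam : Set (Set Y)) : Prop :=
  ∀ y : Y, ∃ O ∈ nhds y, {P ∈ Pfam | (O ∩ P).Nonempty}.Finite

/-- Every compact set meets only finitely many members of `Pfam`. -/
def CompactFiniteFam (Pfam : Set (Set Y)) : Prop :=
  ∀ C : Set Y, IsCompact C → {P ∈ Pfam | (C ∩ P).Nonempty}.Finite

/-- `Pfam` is a base for the topology: all members are open, and every open set is a union of
members around each of its points. -/
def IsBaseFam (Pfam : Set (Set Y)) : Prop :=
  (∀ P ∈ Pfam, IsOpen P) ∧ ∀ U : Set Y, IsOpen U → ∀ y ∈ U, ∃ P ∈ Pfam, y ∈ P ∧ P ⊆ U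

/-- `Pfam` is hereditarily closure-preserving: whenever `S P ⊆ P` is chosen for each `P ∈ Pfam`,
the resulting family is closure-preserving. -/
def IsHCP (Pfam : Set (Set Y)) : Prop :=
  ∀ S : Set Y → Set Y, (∀ P ∈ Pfam, S P ⊆ P) →
    ∀ Qfam ⊆ Pfam, closure (⋃ P ∈ Qfam, S P) = ⋃ P ∈ Qfam, closure (S P)

/-- `Pfam = ⋃_{y} Pfam y` is a weak base: each `Pfam y` consists of sets containing `y`, is directed
downward, every open neighborhood of `y` contains a member of `Pfam y`, and a set `G` is open
whenever each of its points has a member of its family inside `G`. -/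
def IsWeakBase (Pfam : Y → Set (Set Y)) : Prop :=
  (∀ y, ∀ P ∈ Pfam y, y ∈ P) ∧
  (∀ y, ∀ U ∈ Pfam y, ∀ V ∈ Pfam y, ∃ W ∈ Pfam y, W ⊆ U ∩ V) ∧
  (∀ y, ∀ U : Set Y, IsOpen U → y ∈ U → ∃ P ∈ Pfam y, P ⊆ U) ∧
  (∀ G : Set Y, (∀ y ∈ G, ∃ P ∈ Pfam y, P ⊆ G) → IsOpen G)

end Defs

/-- An ℵ-space: a space with a σ-locally finite k-network. -/
def IsAlephSpace (Y : Type*) [TopologicalSpace Y] : Prop :=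
  ∃ Pfam : ℕ → Set (Set Y), (∀ n, LocallyFiniteFam (Pfam n)) ∧ IsKNetwork (⋃ n, Pfam n)

/-- A space with a σ-hereditarily closure-preserving k-network. -/
def HasSigmaHCPKNetwork (Y : Type*) [TopologicalSpace Y] : Prop :=
  ∃ Pfam : ℕ → Set (Set Y), (∀ n, IsHCP (Pfam n)) ∧ IsKNetwork (⋃ n, Pfam n)

/-- k*-metrizable: a space with a σ-compact-finite k-network. -/
def KStarMetrizable (Y : Type*) [TopologicalSpace Y] : Prop :=
  ∃ Pfam : ℕ → Set (Set Y), (∀ n, CompactFiniteFam (Pfam n)) ∧ IsKNetwork (⋃ n, Pfam n)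

section Helpers

variable {X : Type*} [TopologicalSpace X]

theorem VHyper.isOpen_sub {U : Set X} (hU : IsOpen U) :
    IsOpen {A : VHyper X | A.carrier ⊆ U} := by
  apply TopologicalSpace.isOpen_generateFrom_of_mem
  refine ⟨{U}, by simpa using hU, ?_⟩
  ext A
  simp only [VHyper.vbox, Set.mem_setOf_eq, Finset.coe_singleton, Set.sUnion_singleton,
    Finset.mem_singleton, forall_eq]
  refine ⟨fun h => ⟨h, ?_⟩, fun h => h.1⟩
  rw [Set.inter_eq_left.2 h]
  exact A.nonempty'

theorem VHyper.isOpen_meet {U : Set X} (hU : IsOpen U) :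
    IsOpen {A : VHyper X | (A.carrier ∩ U).Nonempty} := by
  classical
  apply TopologicalSpace.isOpen_generateFrom_of_mem
  refine ⟨{Set.univ, U}, by simpa using hU, ?_⟩
  ext A
  simp [VHyper.vbox, A.nonempty']

theorem VHyper.isCompact_union {C : Set (VHyper X)} (hC : IsCompact C) :
    IsCompact (⋃ A ∈ C, A.carrier) := by
  classical
  apply isCompact_of_finite_subcover
  intro ι U hU hcov
  have h1 : ∀ A ∈ C, ∃ t : Finset ι, A.carrier ⊆ ⋃ i ∈ t, U i := fun A hA =>
    A.isCompact'.elim_finite_subcover U hU ((Set.subset_biUnion_of_mem hA).trans hcov)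
  obtain ⟨T, hT⟩ := hC.elim_finite_subcover
    (fun t : Finset ι => {A : VHyper X | A.carrier ⊆ ⋃ i ∈ t, U i})
    (fun t => VHyper.isOpen_sub (isOpen_biUnion fun i _ => hU i))
    (fun A hA => Set.mem_iUnion.2 (h1 A hA))
  refine ⟨T.biUnion id, ?_⟩
  intro x hx
  simp only [Set.mem_iUnion] at hx
  obtain ⟨A, hA, hx⟩ := hx
  have := hT hA
  simp only [Set.mem_iUnion] at this
  obtain ⟨t, ht, hAt⟩ := this
  have := hAt hx
  simp only [Set.mem_iUnion] at this ⊢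
  obtain ⟨i, hi, hxi⟩ := this
  exact ⟨i, Finset.mem_biUnion.2 ⟨t, ht, hi⟩, hxi⟩

theorem VHyper.box_sub {Pfam : Set (Set X)} {O : Set (VHyper X)} {S : Set X}
    (h : ∀ A ∈ O, A.carrier ⊆ S) :
    {B ∈ boxFamily Pfam | (O ∩ B).Nonempty} ⊆
      VHyper.vbox '' ((fun Ps : Finset (Set X) => (Ps : Set (Set X))) ⁻¹'
        {t | t.Finite ∧ t ⊆ {P ∈ Pfam | (S ∩ P).Nonempty}}) := by
  rintro B ⟨⟨Ps, -, hPs, rfl⟩, A, hAO, hA⟩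
  exact ⟨Ps, ⟨Ps.finite_toSet, fun P hP =>
    ⟨hPs hP, (hA.2 P hP).mono (Set.inter_subset_inter_left _ (h A hAO))⟩⟩, rfl⟩

theorem VHyper.box_countable {Pfam : Set (Set X)} {O : Set (VHyper X)} {S : Set X}
    (h : ∀ A ∈ O, A.carrier ⊆ S) (hS : {P ∈ Pfam | (S ∩ P).Nonempty}.Countable) :
    {B ∈ boxFamily Pfam | (O ∩ B).Nonempty}.Countable :=
  (((Set.countable_setOf_finite_subset hS).preimage Finset.coe_injective).image _).mono
    (VHyper.box_sub h)

theorem VHyper.box_finite {Pfam : Set (Set X)} {O : Set (VHyper X)} {S : Set X}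
    (h : ∀ A ∈ O, A.carrier ⊆ S) (hS : {P ∈ Pfam | (S ∩ P).Nonempty}.Finite) :
    {B ∈ boxFamily Pfam | (O ∩ B).Nonempty}.Finite :=
  (((hS.finite_subsets.subset (fun _ ht => ht.2)).preimage
    Finset.coe_injective.injOn).image _).subset (VHyper.box_sub h)

theorem VHyper.meet_union (Pfam : Set (Set X)) (S T : Set X) :
    {P ∈ Pfam | ((S ∪ T) ∩ P).Nonempty} ⊆
      {P ∈ Pfam | (S ∩ P).Nonempty} ∪ {P ∈ Pfam | (T ∩ P).Nonempty} := by
  rintro P ⟨hP, x, hx | hx, hxP⟩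
  · exact Or.inl ⟨hP, x, hx, hxP⟩
  · exact Or.inr ⟨hP, x, hx, hxP⟩

/-- A property of sets (closed under binary unions, subsets) holding locally holds on an open
neighbourhood of every compact set. -/
theorem VHyper.open_nhd {p : Set X → Prop} (h0 : p ∅) (hmono : ∀ S T, S ⊆ T → p T → p S)
    (hun : ∀ S T, p S → p T → p (S ∪ T)) (hloc : ∀ x, ∃ O ∈ nhds x, p O)
    {K : Set X} (hK : IsCompact K) : ∃ U, IsOpen U ∧ K ⊆ U ∧ p U := by
  refine hK.induction_on (p := fun K => ∃ U, IsOpen U ∧ K ⊆ U ∧ p U) ?_ ?_ ?_ ?_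
  · exact ⟨∅, isOpen_empty, subset_rfl, h0⟩
  · rintro s t hst ⟨U, hU, htU, hp⟩
    exact ⟨U, hU, hst.trans htU, hp⟩
  · rintro s t ⟨U, hU, hs, hp⟩ ⟨V, hV, ht, hq⟩
    exact ⟨U ∪ V, hU.union hV, Set.union_subset_union hs ht, hun _ _ hp hq⟩
  · intro x _
    obtain ⟨O, hO, hp⟩ := hloc x
    obtain ⟨V, hVO, hV, hx⟩ := mem_nhds_iff.1 hO
    exact ⟨V, mem_nhdsWithin_of_mem_nhds (hV.mem_nhds hx), V, hV, subset_rfl,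
      hmono _ _ hVO hp⟩

theorem VHyper.meet_mono (Pfam : Set (Set X)) {S T : Set X} (h : S ⊆ T) :
    {P ∈ Pfam | (S ∩ P).Nonempty} ⊆ {P ∈ Pfam | (T ∩ P).Nonempty} :=
  fun _ hP => ⟨hP.1, hP.2.mono (Set.inter_subset_inter_left _ h)⟩

end Helpers

/-- If `Pfam` is compact-countable (resp. locally countable, locally finite, compact-finite),
then so is `ℬ = {⟨P₁,…,P_r⟩ : Pᵢ ∈ Pfam}` in `𝒦(X)`; and if all members of `Pfam` are
closed, all members of `ℬ` are closed in `𝒦(X)`. -/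
theorem statement1 {X : Type*} [TopologicalSpace X] [T2Space X] [RegularSpace X]
    (Pfam : Set (Set X)) :
    (CompactCountableFam Pfam → CompactCountableFam (boxFamily Pfam)) ∧
    (LocallyCountableFam Pfam → LocallyCountableFam (boxFamily Pfam)) ∧
    (LocallyFiniteFam Pfam → LocallyFiniteFam (boxFamily Pfam)) ∧
    (CompactFiniteFam Pfam → CompactFiniteFam (boxFamily Pfam)) ∧
    ((∀ P ∈ Pfam, IsClosed P) → ∀ B ∈ boxFamily Pfam, IsClosed B) := by
  refine ⟨?_, ?_, ?_, ?_, ?_⟩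
  · intro h C hC
    exact VHyper.box_countable (fun A hA => Set.subset_biUnion_of_mem (u := VHyper.carrier) hA)
      (h _ (VHyper.isCompact_union hC))
  · intro h K
    obtain ⟨U, hU, hKU, hp⟩ := VHyper.open_nhd
      (p := fun S => {P ∈ Pfam | (S ∩ P).Nonempty}.Countable) (by simp)
      (fun S T hST hT => hT.mono (VHyper.meet_mono Pfam hST))
      (fun S T hS hT => (hS.union hT).mono (VHyper.meet_union Pfam S T)) h K.isCompact'
    exact ⟨_, (VHyper.isOpen_sub hU).mem_nhds hKU, VHyper.box_countable (fun A hA => hA) hp⟩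
  · intro h K
    obtain ⟨U, hU, hKU, hp⟩ := VHyper.open_nhd
      (p := fun S => {P ∈ Pfam | (S ∩ P).Nonempty}.Finite) (by simp)
      (fun S T hST hT => hT.subset (VHyper.meet_mono Pfam hST))
      (fun S T hS hT => (hS.union hT).subset (VHyper.meet_union Pfam S T)) h K.isCompact'
    exact ⟨_, (VHyper.isOpen_sub hU).mem_nhds hKU, VHyper.box_finite (fun A hA => hA) hp⟩
  · intro h C hC
    exact VHyper.box_finite (fun A hA => Set.subset_biUnion_of_mem (u := VHyper.carrier) hA)
      (h _ (VHyper.isCompact_union hC))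
  · rintro h B ⟨Ps, -, hPs, rfl⟩
    have hF : IsClosed (⋃₀ (Ps : Set (Set X))) := by
      rw [Set.sUnion_eq_biUnion]
      exact Set.Finite.isClosed_biUnion Ps.finite_toSet fun P hP => h P (hPs hP)
    have h1 : IsClosed {A : VHyper X | A.carrier ⊆ ⋃₀ (Ps : Set (Set X))} := by
      rw [← isOpen_compl_iff]
      convert VHyper.isOpen_meet hF.isOpen_compl using 1
      ext A
      simp only [Set.mem_compl_iff, Set.mem_setOf_eq, Set.inter_compl_nonempty_iff]
    have h2 : ∀ P ∈ Ps, IsClosed {A : VHyper X | (A.carrier ∩ P).Nonempty} := by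
      intro P hP
      rw [← isOpen_compl_iff]
      convert VHyper.isOpen_sub (h P (hPs hP)).isOpen_compl using 1
      ext A
      simp only [Set.mem_compl_iff, Set.mem_setOf_eq, Set.not_nonempty_iff_eq_empty,
        Set.subset_compl_iff_disjoint_right, Set.disjoint_iff_inter_eq_empty]
    have h3 : VHyper.vbox Ps = {A : VHyper X | A.carrier ⊆ ⋃₀ (Ps : Set (Set X))} ∩
        ⋂ P ∈ Ps, {A : VHyper X | (A.carrier ∩ P).Nonempty} := by
      ext A
      simp [VHyper.vbox]
    rw [h3]
    exact h1.inter (isClosed_biInter h2)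
end

section
/- A regular T2 space X is k*-metrizable (i.e., has a σ-compact-finite k-network) if and only if the hyperspace 𝒦(X) with the Vietoris topology is k*-metrizable. -/
open TopologicalSpace Set

namespace VHyper

variable {X : Type*} [TopologicalSpace X]

theorem isOpen_sub_s6 {W : Set X} (hW : IsOpen W) : IsOpen {B : VHyper X | B.carrier ⊆ W} := by
  apply TopologicalSpace.isOpen_generateFrom_of_mem
  refine ⟨{W}, by simpa using hW, ?_⟩
  ext B
  simp only [vbox, mem_setOf_eq, Finset.coe_singleton, sUnion_singleton, Finset.mem_singleton,
    forall_eq]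
  constructor
  · intro h
    obtain ⟨x, hx⟩ := B.nonempty'
    exact ⟨h, x, hx, h hx⟩
  · exact fun h => h.1

theorem isOpen_meet_s6 {V : Set X} (hV : IsOpen V) :
    IsOpen {B : VHyper X | (B.carrier ∩ V).Nonempty} := by
  classical
  apply TopologicalSpace.isOpen_generateFrom_of_mem
  refine ⟨{V, univ}, by simpa using hV, ?_⟩
  ext B
  simp [vbox, B.nonempty']

theorem exists_basic {O : Set (VHyper X)} (hO : IsOpen O) : ∀ A ∈ O,
    ∃ W : Set X, IsOpen W ∧ A.carrier ⊆ W ∧ ∃ T : Set (Set X), T.Finite ∧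
      (∀ U ∈ T, IsOpen U ∧ (A.carrier ∩ U).Nonempty) ∧
      ∀ B : VHyper X, B.carrier ⊆ W → (∀ U ∈ T, (B.carrier ∩ U).Nonempty) → B ∈ O := by
  induction hO with
  | basic s hs =>
    obtain ⟨Ps, hPs, rfl⟩ := hs
    intro A hA
    exact ⟨⋃₀ Ps, isOpen_sUnion hPs, hA.1, Ps, Ps.finite_toSet,
      fun U hU => ⟨hPs U hU, hA.2 U hU⟩, fun B h1 h2 => ⟨h1, h2⟩⟩
  | univ =>
    intro A _
    exact ⟨univ, isOpen_univ, subset_univ _, ∅, finite_empty, by simp, by simp⟩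
  | inter s t _ _ ihs iht =>
    intro A hA
    obtain ⟨W, hW, hAW, T, hT, hT2, h⟩ := ihs A hA.1
    obtain ⟨W', hW', hAW', T', hT', hT2', h'⟩ := iht A hA.2
    refine ⟨W ∩ W', hW.inter hW', subset_inter hAW hAW', T ∪ T', hT.union hT', ?_, ?_⟩
    · rintro U (hU | hU)
      exacts [hT2 U hU, hT2' U hU]
    · intro B h1 h2
      exact ⟨h B (h1.trans inter_subset_left) fun U hU => h2 U (Or.inl hU),
        h' B (h1.trans inter_subset_right) fun U hU => h2 U (Or.inr hU)⟩
  | sUnion S _ ih =>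
    rintro A ⟨s, hs, hA⟩
    obtain ⟨W, hW, hAW, T, hT, hT2, h⟩ := ih s hs A hA
    exact ⟨W, hW, hAW, T, hT, hT2, fun B h1 h2 => ⟨s, hs, h B h1 h2⟩⟩

theorem isCompact_union_s6 {C : Set (VHyper X)} (hC : IsCompact C) :
    IsCompact (⋃ A ∈ C, A.carrier) := by
  classical
  apply isCompact_of_finite_subcover
  intro ι U hU hcov
  have : ∃ t : Finset ι, ∀ B ∈ C, B.carrier ⊆ ⋃ i ∈ t, U i := by
    refine hC.induction_on (p := fun s => ∃ t : Finset ι, ∀ B ∈ s, B.carrier ⊆ ⋃ i ∈ t, U i)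
      ⟨∅, by simp⟩ ?_ ?_ ?_
    · rintro s t hst ⟨f, hf⟩
      exact ⟨f, fun B hB => hf B (hst hB)⟩
    · rintro s t ⟨f, hf⟩ ⟨g, hg⟩
      refine ⟨f ∪ g, ?_⟩
      rintro B (hB | hB)
      · exact (hf B hB).trans (biUnion_subset_biUnion_left fun i hi => Finset.mem_union_left _ hi)
      · exact (hg B hB).trans (biUnion_subset_biUnion_left fun i hi => Finset.mem_union_right _ hi)
    · intro A hA
      obtain ⟨t, ht⟩ := A.isCompact'.elim_finite_subcover U hU
        ((subset_biUnion_of_mem (u := fun A : VHyper X => A.carrier) hA).trans hcov)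
      refine ⟨{B | B.carrier ⊆ ⋃ i ∈ t, U i}, mem_nhdsWithin_of_mem_nhds ?_, t, fun B hB => hB⟩
      exact (isOpen_sub_s6 (isOpen_biUnion fun i _ => hU i)).mem_nhds ht
  obtain ⟨t, ht⟩ := this
  exact ⟨t, iUnion₂_subset ht⟩

theorem continuous_single : Continuous
    (fun x : X => (⟨{x}, isCompact_singleton, singleton_nonempty x⟩ : VHyper X)) := by
  apply continuous_generateFrom_iff.2
  rintro _ ⟨Ps, hPs, rfl⟩
  have : (fun x : X => (⟨{x}, isCompact_singleton, singleton_nonempty x⟩ : VHyper X)) ⁻¹'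
      (vbox Ps) = (⋃₀ Ps) ∩ ⋂ P ∈ Ps, P := by
    ext x
    simp [vbox]
  rw [this]
  exact (isOpen_sUnion hPs).inter (isOpen_biInter_finset hPs)

theorem local_claim [RegularSpace X] {Pf : Set (Set X)} (hP : IsKNetwork Pf)
    {C : Set (VHyper X)} (hC : IsCompact C) {O : Set (VHyper X)} (hO : IsOpen O)
    (A : VHyper X) (hA : A ∈ O) :
    ∃ V ∈ nhds A, ∃ F : Set (Set (VHyper X)),
      F ⊆ {S | ∃ Ps : Finset (Set X), (Ps : Set (Set X)) ⊆ Pf ∧ S = vbox Ps} ∧ F.Finite ∧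
      V ∩ C ⊆ ⋃₀ F ∧ ⋃₀ F ⊆ O := by
  classical
  set K := ⋃ A ∈ C, A.carrier with hK
  have hKc : IsCompact K := isCompact_union_s6 hC
  obtain ⟨W, hW, hAW, T, hT, hT2, h⟩ := exists_basic hO A hA
  obtain ⟨V0, hV0, hAV0, hcl0⟩ : ∃ V : Set X, IsOpen V ∧ A.carrier ⊆ V ∧ closure V ⊆ W := by
    obtain ⟨V, h1, h2, h3⟩ := A.isCompact'.exists_isOpen_closure_subset (hW.mem_nhdsSet.2 hAW)
    exact ⟨V, h1, h2, h3⟩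
  have hV : ∀ U ∈ T, ∃ V : Set X, IsOpen V ∧ (A.carrier ∩ V).Nonempty ∧ closure V ⊆ U ∩ W := by
    intro U hU
    obtain ⟨hUo, x, hx, hxU⟩ := hT2 U hU
    obtain ⟨V, h1, h2, h3⟩ := (isCompact_singleton (x := x)).exists_isOpen_closure_subset
      ((hUo.inter hW).mem_nhdsSet.2 (singleton_subset_iff.2 ⟨hxU, hAW hx⟩))
    exact ⟨V, h1, ⟨x, hx, h2 rfl⟩, h3⟩
  choose! V hVo hAV hVc using hV
  obtain ⟨Q0, hQ0P, hQ0f, hQ0c, hQ0W⟩ := hP (K ∩ closure V0) (hKc.inter_right isClosed_closure)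
    W hW (inter_subset_right.trans hcl0)
  have hQ : ∀ U ∈ T, ∃ Q : Set (Set X), Q ⊆ Pf ∧ Q.Finite ∧ K ∩ closure (V U) ⊆ ⋃₀ Q ∧
      ⋃₀ Q ⊆ U ∩ W := fun U hU =>
    hP (K ∩ closure (V U)) (hKc.inter_right isClosed_closure) (U ∩ W) ((hT2 U hU).1.inter hW)
      (inter_subset_right.trans (hVc U hU))
  choose! Q hQP hQf hQc hQU using hQ
  set R : Set (Set X) := Q0 ∪ ⋃ U ∈ T, Q U with hR
  have hRf : R.Finite := hQ0f.union (hT.biUnion hQf)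
  have hRP : R ⊆ Pf := union_subset hQ0P (iUnion₂_subset hQP)
  have hRW : ∀ S ∈ R, S ⊆ W := by
    rintro S (hS | hS)
    · exact (subset_sUnion_of_mem hS).trans hQ0W
    · obtain ⟨U, hU, hS⟩ := mem_iUnion₂.1 hS
      exact (subset_sUnion_of_mem hS).trans ((hQU U hU).trans inter_subset_right)
  let sel : VHyper X → Finset (Set X) :=
    fun B => hRf.toFinset.filter fun S => (B.carrier ∩ S).Nonempty
  have hsel : ∀ B S, S ∈ sel B ↔ S ∈ R ∧ (B.carrier ∩ S).Nonempty := by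
    intro B S
    simp [sel]
  set N : Set (VHyper X) := {B | B.carrier ⊆ V0} ∩
    ⋂ U ∈ T, {B | (B.carrier ∩ V U).Nonempty} with hN
  refine ⟨N, ?_, (fun B => vbox (sel B)) '' (N ∩ C), ?_, ?_, ?_, ?_⟩
  · exact ((isOpen_sub_s6 hV0).inter (hT.isOpen_biInter fun U hU => isOpen_meet_s6 (hVo U hU))).mem_nhds
      ⟨hAV0, mem_iInter₂.2 hAV⟩
  · rintro _ ⟨B, -, rfl⟩
    exact ⟨sel B, fun S hS => hRP ((hsel B S).1 hS).1, rfl⟩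
  · refine (hRf.toFinset.powerset.finite_toSet.image vbox).subset ?_
    rintro _ ⟨B, -, rfl⟩
    exact ⟨sel B, by simp only [Finset.coe_powerset, mem_preimage, mem_powerset_iff,
      Finset.coe_subset, sel]; exact Finset.filter_subset _ _, rfl⟩
  · rintro B ⟨hBN, hBC⟩
    refine ⟨_, ⟨B, ⟨hBN, hBC⟩, rfl⟩, ?_, fun S hS => ((hsel B S).1 hS).2⟩
    intro x hx
    obtain ⟨S, hS, hxS⟩ := hQ0c ⟨mem_biUnion hBC hx, subset_closure (hBN.1 hx)⟩
    exact ⟨S, (hsel B S).2 ⟨Or.inl hS, x, hx, hxS⟩, hxS⟩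
  · rintro B' ⟨_, ⟨B, ⟨hBN, hBC⟩, rfl⟩, hB1, hB2⟩
    refine h B' (hB1.trans (sUnion_subset fun S hS => hRW S ((hsel B S).1 hS).1)) ?_
    intro U hU
    obtain ⟨x, hx, hxV⟩ := mem_iInter₂.1 hBN.2 U hU
    obtain ⟨S, hS, hxS⟩ := hQc U hU ⟨mem_biUnion hBC hx, subset_closure hxV⟩
    obtain ⟨y, hy, hyS⟩ := hB2 S ((hsel B S).2
      ⟨Or.inr (mem_biUnion hU hS), x, hx, hxS⟩)
    exact ⟨y, hy, (hQU U hU ⟨S, hS, hyS⟩).1⟩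

end VHyper

/-- `X` is k*-metrizable (has a σ-compact-finite k-network) iff `𝒦(X)` is. -/
theorem statement6 {X : Type*} [TopologicalSpace X] [T2Space X] [RegularSpace X] :
    KStarMetrizable X ↔ KStarMetrizable (VHyper X) := by
  classical
  constructor
  · rintro ⟨P, hPf, hP⟩
    refine ⟨fun n => {S | ∃ Ps : Finset (Set X), (Ps : Set (Set X)) ⊆ ⋃ m ∈ Finset.range n, P m ∧
      S = VHyper.vbox Ps}, ?_, ?_⟩
    · intro n C hC
      have hK := VHyper.isCompact_union_s6 hC
      have hfin : (⋃ m ∈ Finset.range n,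
          {S ∈ P m | ((⋃ A ∈ C, A.carrier) ∩ S).Nonempty}).Finite :=
        (Finset.range n).finite_toSet.biUnion fun m _ => hPf m _ hK
      refine (hfin.toFinset.powerset.finite_toSet.image VHyper.vbox).subset ?_
      rintro _ ⟨⟨Ps, hPs, rfl⟩, A, hAC, hA⟩
      refine ⟨Ps, ?_, rfl⟩
      rw [Finset.mem_coe, Finset.mem_powerset]
      intro S hS
      rw [Set.Finite.mem_toFinset]
      obtain ⟨m, hm, hSm⟩ := mem_iUnion₂.1 (hPs hS)
      obtain ⟨x, hx, hxS⟩ := hA.2 S hS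
      exact mem_biUnion hm ⟨hSm, x, mem_biUnion hAC hx, hxS⟩
    · intro C hC O hO hCO
      have key : ∃ F : Set (Set (VHyper X)),
          F ⊆ {S | ∃ Ps : Finset (Set X), (Ps : Set (Set X)) ⊆ ⋃ n, P n ∧ S = VHyper.vbox Ps} ∧
          F.Finite ∧ C ⊆ ⋃₀ F ∧ ⋃₀ F ⊆ O := by
        refine hC.induction_on (p := fun s => ∃ F : Set (Set (VHyper X)),
          F ⊆ {S | ∃ Ps : Finset (Set X), (Ps : Set (Set X)) ⊆ ⋃ n, P n ∧ S = VHyper.vbox Ps} ∧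
          F.Finite ∧ s ⊆ ⋃₀ F ∧ ⋃₀ F ⊆ O) ⟨∅, by simp⟩ ?_ ?_ ?_
        · rintro s t hst ⟨F, h1, h2, h3, h4⟩
          exact ⟨F, h1, h2, hst.trans h3, h4⟩
        · rintro s t ⟨F, h1, h2, h3, h4⟩ ⟨G, g1, g2, g3, g4⟩
          refine ⟨F ∪ G, union_subset h1 g1, h2.union g2, ?_, ?_⟩
          · rw [sUnion_union]
            exact union_subset_union h3 g3
          · rw [sUnion_union]
            exact union_subset h4 g4
        · intro A hA
          obtain ⟨V, hV, F, h1, h2, h3, h4⟩ := VHyper.local_claim hP hC hO A (hCO hA)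
          exact ⟨V ∩ C, Filter.inter_mem (mem_nhdsWithin_of_mem_nhds hV) self_mem_nhdsWithin,
            F, h1, h2, h3, h4⟩
      obtain ⟨F, h1, h2, h3, h4⟩ := key
      refine ⟨F, ?_, h2, h3, h4⟩
      intro S hS
      obtain ⟨Ps, hPs, rfl⟩ := h1 hS
      have : ∀ S ∈ Ps, ∃ n, S ∈ P n := fun S hS => mem_iUnion.1 (hPs hS)
      choose! g hg using this
      refine mem_iUnion.2 ⟨Ps.sup g + 1, Ps, ?_, rfl⟩
      intro S hS
      exact mem_biUnion (x := g S) (by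
        simpa [Nat.lt_succ_iff] using Finset.le_sup (f := g) hS) (hg S hS)
  · rintro ⟨P, hPf, hP⟩
    set s := fun x : X => (⟨{x}, isCompact_singleton, singleton_nonempty x⟩ : VHyper X) with hs
    have hsc : Continuous s := VHyper.continuous_single
    refine ⟨fun n => (fun S => s ⁻¹' S) '' P n, ?_, ?_⟩
    · intro n C hC
      refine ((hPf n _ (hC.image hsc)).image (fun S => s ⁻¹' S)).subset ?_
      rintro _ ⟨⟨S, hS, rfl⟩, x, hx, hxS⟩
      exact ⟨S, ⟨hS, s x, mem_image_of_mem _ hx, hxS⟩, rfl⟩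
    · intro C hC U hU hCU
      obtain ⟨F, h1, h2, h3, h4⟩ := hP (s '' C) (hC.image hsc) _ (VHyper.isOpen_sub_s6 hU) (by
        rintro _ ⟨x, hx, rfl⟩
        simpa [hs] using hCU hx)
      refine ⟨(fun S => s ⁻¹' S) '' F, ?_, h2.image _, ?_, ?_⟩
      · rintro _ ⟨S, hS, rfl⟩
        obtain ⟨n, hn⟩ := mem_iUnion.1 (h1 hS)
        exact mem_iUnion.2 ⟨n, S, hn, rfl⟩
      · intro x hx
        obtain ⟨S, hS, hxS⟩ := h3 (mem_image_of_mem s hx)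
        exact ⟨_, ⟨S, hS, rfl⟩, hxS⟩
      · rintro x ⟨_, ⟨S, hS, rfl⟩, hxS⟩
        have := h4 ⟨S, hS, hxS⟩
        simpa [hs] using this
end
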